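/- (Noskov) Let G be a polynomial extension of Q by H (with respect to a section σ), with ℓ the word-length function on G associated to the generating set ι(A) ∪ σ(𝒬). If H has the Rapid Decay property with respect to ℓ_H and Q has the Rapid Decay property with respect to ℓ_Q, then G has the Rapid Decay property with respect to ℓ. -/

import Mathlib

/-- The word-length function associated to a generating set `S` of a group. -/
noncomputable def wordLength {G : Type*} [Group G] (S : Set G) (g : G) : ℕ :=
  sInf {n | ∃ w : List G, w.length = n ∧ (∀ x ∈ w, x ∈ S ∨ x⁻¹ ∈ S) ∧ w.prod = g}

/-- A group `G` has the Rapid Decay property with respect to a length function `ℓ` if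
there exist `C > 0` and `k ∈ ℕ` such that `‖f⋆g‖₂ ≤ C·‖f‖_{2,k}·‖g‖₂` for all finitely
supported `f, g : G → ℂ`. -/
def RapidDecay (G : Type*) [Group G] (ℓ : G → ℝ) : Prop :=
  ∃ C : ℝ, 0 < C ∧ ∃ k : ℕ, ∀ f g : G → ℂ,
    (Function.support f).Finite → (Function.support g).Finite →
    Real.sqrt (∑' x : G, ‖∑' y : G, f y * g (y⁻¹ * x)‖ ^ 2) ≤
      C * Real.sqrt (∑' x : G, ‖f x‖ ^ 2 * (1 + ℓ x) ^ (2 * k)) *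
        Real.sqrt (∑' x : G, ‖g x‖ ^ 2)


namespace PolyExt

section WL
variable {G : Type*} [Group G] {S : Set G}

theorem wl_le (w : List G) (hw : ∀ x ∈ w, x ∈ S ∨ x⁻¹ ∈ S) : wordLength S w.prod ≤ w.length :=
  Nat.sInf_le ⟨w, rfl, hw, rfl⟩

theorem wl_exists (hS : Subgroup.closure S = ⊤) (g : G) :
    ∃ w : List G, w.length = wordLength S g ∧ (∀ x ∈ w, x ∈ S ∨ x⁻¹ ∈ S) ∧ w.prod = g := by
  have hne : {n | ∃ w : List G, w.length = n ∧ (∀ x ∈ w, x ∈ S ∨ x⁻¹ ∈ S) ∧ w.prod = g}.Nonempty := by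
    have hg : g ∈ (Subgroup.closure S).toSubmonoid := by rw [hS]; trivial
    rw [Subgroup.closure_toSubmonoid] at hg
    obtain ⟨l, hl, h⟩ := Submonoid.exists_list_of_mem_closure hg
    exact ⟨l.length, l, rfl, fun x hx => by simpa using hl x hx, h⟩
  exact Nat.sInf_mem hne

theorem wl_mul (hS : Subgroup.closure S = ⊤) (g h : G) :
    wordLength S (g * h) ≤ wordLength S g + wordLength S h := by
  obtain ⟨w, hw, hw', hp⟩ := wl_exists hS g
  obtain ⟨v, hv, hv', hq⟩ := wl_exists hS h
  have := wl_le (S := S) (w ++ v) (by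
    intro x hx
    rcases List.mem_append.1 hx with hx | hx
    · exact hw' x hx
    · exact hv' x hx)
  simpa [hp, hq, hw, hv] using this

theorem wl_inv_le (hS : Subgroup.closure S = ⊤) (g : G) :
    wordLength S g⁻¹ ≤ wordLength S g := by
  obtain ⟨w, hw, hw', hp⟩ := wl_exists hS g
  have := wl_le (S := S) ((w.map (·⁻¹)).reverse) (by
    intro x hx
    simp only [List.mem_reverse, List.mem_map] at hx
    obtain ⟨y, hy, rfl⟩ := hx
    rcases hw' y hy with h | h
    · right; simpa using h
    · left; exact h)
  rw [← List.prod_inv_reverse, hp] at this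
  simpa [hw] using this

theorem wl_gen {x : G} (hx : x ∈ S ∨ x⁻¹ ∈ S) : wordLength S x ≤ 1 := by
  have := wl_le (S := S) [x] (by simpa using hx)
  simpa using this

end WL

section L2
variable {X : Type*}

/-- The l2 norm -/
noncomputable def N (u : X → ℂ) : ℝ := Real.sqrt (∑' x, ‖u x‖ ^ 2)

theorem N_nonneg (u : X → ℂ) : 0 ≤ N u := Real.sqrt_nonneg _

theorem N_sq (u : X → ℂ) : N u ^ 2 = ∑' x, ‖u x‖ ^ 2 :=
  Real.sq_sqrt (tsum_nonneg fun _ => by positivity)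

theorem N_zero : N (fun _ : X => (0 : ℂ)) = 0 := by simp [N]

theorem N_eq (u : X → ℂ) (s : Finset X) (hs : Function.support u ⊆ s) :
    N u = ‖(WithLp.toLp 2 (fun x : s => u x) : EuclideanSpace ℂ s)‖ := by
  rw [EuclideanSpace.norm_eq, N]
  congr 1
  rw [tsum_eq_sum (s := s)]
  · exact (Finset.sum_coe_sort s (fun x => ‖u x‖ ^ 2)).symm
  · intro x hx
    have : u x = 0 := by
      by_contra h
      exact hx (hs h)
    simp [this]

theorem N_add (u v : X → ℂ) (hu : (Function.support u).Finite) (hv : (Function.support v).Finite) :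
    N (fun x => u x + v x) ≤ N u + N v := by
  classical
  set s : Finset X := hu.toFinset ∪ hv.toFinset with hsdef
  have h1 : Function.support u ⊆ s := by intro x hx; simp [hsdef]; left; exact hx
  have h2 : Function.support v ⊆ s := by intro x hx; simp [hsdef]; right; exact hx
  have h3 : Function.support (fun x => u x + v x) ⊆ s :=
    (Function.support_add u v).trans (Set.union_subset h1 h2)
  rw [N_eq u s h1, N_eq v s h2, N_eq _ s h3]
  exact norm_add_le (WithLp.toLp 2 (fun x : s => u x) : EuclideanSpace ℂ s) (WithLp.toLp 2 (fun x : s => v x))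

theorem N_sum {I : Type*} (T : Finset I) (u : I → X → ℂ)
    (hu : ∀ i, (Function.support (u i)).Finite) :
    N (fun x => ∑ i ∈ T, u i x) ≤ ∑ i ∈ T, N (u i) := by
  classical
  induction T using Finset.induction_on with
  | empty => simp [N_zero]
  | insert a s ha ih =>
    simp only [Finset.sum_insert ha]
    refine (N_add _ _ (hu a) ?_).trans (by gcongr)
    refine (s.finite_toSet.biUnion fun i _ => hu i).subset ?_
    intro x hx
    obtain ⟨i, hi, hne⟩ := Finset.exists_ne_zero_of_sum_ne_zero hx
    exact Set.mem_biUnion (by exact hi) hne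

end L2

theorem conv_support {G : Type*} [Group G] (f g : G → ℂ)
    (hf : (Function.support f).Finite) (hg : (Function.support g).Finite) :
    (Function.support fun x => ∑' y, f y * g (y⁻¹ * x)).Finite := by
  refine (Set.Finite.image2 (fun a b => a * b) hf hg).subset ?_
  intro x hx
  by_contra hn
  apply hx
  simp only
  rw [tsum_congr (g := fun _ => (0 : ℂ)), tsum_zero]
  intro y
  by_contra hne
  rcases not_or.1 (fun h => hne (mul_eq_zero.2 h)) with ⟨h1, h2⟩
  exact hn ⟨y, h1, y⁻¹ * x, h2, by simp⟩

section Ext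
variable {H G Q : Type*} [Group H] [Group G] [Group Q]
    (ι : H →* G) (π : G →* Q)
    (hι : Function.Injective ι) (hexact : ι.range = π.ker)
include hι hexact

theorem pi_iota (h : H) : π (ι h) = 1 := by
  have : ι h ∈ π.ker := hexact ▸ ⟨h, rfl⟩
  exact this

theorem fib_bij (a b : G) (q : Q) (hq : π a * π b = q) :
    Function.Bijective (fun h : H => (⟨a * ι h * b, by
      simp [pi_iota ι π hι hexact, hq]⟩ : {x : G // π x = q})) := by
  constructor
  · intro h h' hh
    have := congrArg Subtype.val hh
    simp only [mul_left_inj, mul_right_inj] at this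
    exact hι this
  · rintro ⟨x, hx⟩
    have : a⁻¹ * x * b⁻¹ ∈ ι.range := by
      rw [hexact, MonoidHom.mem_ker, map_mul, map_mul, hx, ← hq]; simp
    obtain ⟨h, hh⟩ := this
    exact ⟨h, Subtype.ext (by simp only [hh]; group)⟩

theorem fib_sum (F : G → ℝ) (a b : G) (q : Q) (hq : π a * π b = q) :
    ∑' h, F (a * ι h * b) = ∑' x : {x : G // π x = q}, F x :=
  (Equiv.ofBijective _ (fib_bij ι π hι hexact a b q hq)).tsum_eq (fun x : {x : G // π x = q} => F x)

variable (σ : Q → G) (hσ : ∀ q, π (σ q) = q)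
include hσ

theorem e_bij : Function.Bijective (fun p : Q × H => ι p.2 * σ p.1) := by
  constructor
  · rintro ⟨q, h⟩ ⟨q', h'⟩ hh
    have h1 := congrArg π hh
    simp [pi_iota ι π hι hexact, hσ] at h1
    subst h1
    simp only [mul_left_inj] at hh
    rw [hι hh]
  · intro x
    have : x * (σ (π x))⁻¹ ∈ ι.range := by
      rw [hexact, MonoidHom.mem_ker]; simp [hσ]
    obtain ⟨h, hh⟩ := this
    exact ⟨(π x, h), by simp [hh]⟩

theorem sum_split {E : Type*} [NormedAddCommGroup E] [CompleteSpace E] (F : G → E)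
    (hF : (Function.support F).Finite) :
    ∑' x, F x = ∑' q, ∑' h, F (ι h * σ q) := by
  let e := Equiv.ofBijective _ (e_bij ι π hι hexact σ hσ)
  rw [← e.tsum_eq F]
  have hs : Summable fun p => F (e p) := by
    apply summable_of_hasFiniteSupport
    exact hF.preimage e.injective.injOn
  exact hs.tsum_prod

omit hσ in
theorem fib_fin (F : G → ℂ) (hF : (Function.support F).Finite) (a b : G) :
    (Function.support fun h => F (a * ι h * b)).Finite := by
  refine hF.preimage (f := fun h => a * ι h * b) (Function.Injective.injOn ?_)
  intro h h' hh
  simp only [mul_left_inj, mul_right_inj] at hh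
  exact hι hh

end Ext

theorem analytic {H G Q : Type*} [Group H] [Group G] [Group Q]
    (ι : H →* G) (π : G →* Q)
    (hι : Function.Injective ι) (hexact : ι.range = π.ker)
    (σ : Q → G) (hσ : ∀ q, π (σ q) = q)
    (LH : H → ℝ) (LQ : Q → ℝ) (LG : G → ℝ) (hLH : ∀ h, 0 ≤ LH h) (hLQ : ∀ q, 0 ≤ LQ q)
    (hLG : ∀ g, 0 ≤ LG g)
    (W : ℝ) (hW : 0 < W) (m : ℕ)
    (hb1 : ∀ h q, 1 + LH h ≤ W * (1 + LG (ι h * σ q)) ^ m)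
    (hb2 : ∀ h q, LQ q ≤ LG (ι h * σ q))
    (hH : RapidDecay H LH) (hQ : RapidDecay Q LQ) : RapidDecay G LG := by
  classical
  obtain ⟨C, hC, k, hH⟩ := hH
  obtain ⟨C', hC', k', hQ⟩ := hQ
  refine ⟨C' * C * W ^ k, by positivity, m * k + k', fun f g hf hg => ?_⟩
  set a : Q → ℝ := fun q => Real.sqrt (∑' h, ‖f (ι h * σ q)‖ ^ 2 * (1 + LH h) ^ (2 * k)) with ha
  set b : Q → ℝ := fun q => Real.sqrt (∑' x : {x : G // π x = q}, ‖g x‖ ^ 2) with hb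
  have ha0 : ∀ q, 0 ≤ a q := fun q => Real.sqrt_nonneg _
  have hb0 : ∀ q, 0 ≤ b q := fun q => Real.sqrt_nonneg _
  have hbeq : ∀ (c d : G) q, π c * π d = q → N (fun h => g (c * ι h * d)) = b q := by
    intro c d q hq
    simp only [N, hb]
    rw [fib_sum ι π hι hexact (fun x => ‖g x‖ ^ 2) c d q hq]
  set T : Finset Q := hf.toFinset.image π with hT
  have hfT : ∀ q, q ∉ T → ∀ h, f (ι h * σ q) = 0 := by
    intro q hq h
    by_contra hne
    apply hq
    rw [hT, Finset.mem_image]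
    exact ⟨ι h * σ q, by simpa using hne, by simp [pi_iota ι π hι hexact, hσ]⟩
  have hffib : ∀ q, (Function.support fun h => f (ι h * σ q)).Finite := by
    intro q
    simpa using fib_fin ι π hι hexact f hf 1 (σ q)
  -- the finite supports of a, b
  have haS : ∀ q, q ∉ T → a q = 0 := by
    intro q hq
    simp [ha, hfT q hq]
  have haF : (Function.support fun q => ((C * a q : ℝ) : ℂ)).Finite := by
    refine T.finite_toSet.subset fun q hq => ?_
    by_contra hn
    exact hq (by simp [haS q hn])
  have hbF : (Function.support fun q => ((b q : ℝ) : ℂ)).Finite := by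
    refine (hg.image π).subset fun q hq => ?_
    by_contra hn
    apply hq
    have : ∀ x : {x : G // π x = q}, g x = 0 := by
      rintro ⟨x, hx⟩
      by_contra hne
      exact hn ⟨x, hne, hx⟩
    simp [hb, this]
  set cv : G → ℂ := fun x => ∑' y, f y * g (y⁻¹ * x) with hcv
  have hcvF : (Function.support cv).Finite := conv_support f g hf hg
  set u : Q → Q → H → ℂ := fun q q₁ h =>
    ∑' h₁, f (ι h₁ * σ q₁) * g ((σ q₁)⁻¹ * ι (h₁⁻¹ * h) * σ q) with hu
  have hgF : ∀ q q₁, (Function.support fun h => g ((σ q₁)⁻¹ * ι h * σ q)).Finite := fun q q₁ =>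
    fib_fin ι π hι hexact g hg _ _
  have huF : ∀ q q₁, (Function.support (u q q₁)).Finite := fun q q₁ =>
    conv_support (fun h => f (ι h * σ q₁)) (fun h => g ((σ q₁)⁻¹ * ι h * σ q)) (hffib q₁) (hgF q q₁)
  have hcvu : ∀ q h, cv (ι h * σ q) = ∑ q₁ ∈ T, u q q₁ h := by
    intro q h
    simp only [hcv]
    rw [sum_split ι π hι hexact σ hσ (fun y => f y * g (y⁻¹ * (ι h * σ q)))
      (hf.subset fun y hy => left_ne_zero_of_mul hy)]
    rw [tsum_eq_sum (s := T)]
    · refine Finset.sum_congr rfl fun q₁ _ => ?_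
      simp only [hu]
      refine tsum_congr fun h₁ => ?_
      congr 2
      simp [mul_assoc]
    · intro q₁ hq₁
      simp [hfT q₁ hq₁]
  have hcu : ∀ q q₁, N (u q q₁) ≤ C * a q₁ * b (q₁⁻¹ * q) := by
    intro q q₁
    have := hH (fun h => f (ι h * σ q₁)) (fun h => g ((σ q₁)⁻¹ * ι h * σ q)) (hffib q₁) (hgF q q₁)
    rw [← hbeq (σ q₁)⁻¹ (σ q) (q₁⁻¹ * q) (by simp [hσ])]
    exact this
  set D : Q → ℂ := fun q => ∑' q₁, ((C * a q₁ : ℝ) : ℂ) * ((b (q₁⁻¹ * q) : ℝ) : ℂ) with hD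
  have hDF : (Function.support D).Finite := conv_support _ _ haF hbF
  have hDn : ∀ q, ‖D q‖ = ∑ q₁ ∈ T, C * a q₁ * b (q₁⁻¹ * q) := by
    intro q
    have : D q = ((∑ q₁ ∈ T, C * a q₁ * b (q₁⁻¹ * q) : ℝ) : ℂ) := by
      simp only [hD]
      rw [tsum_eq_sum (s := T)]
      · push_cast; rfl
      · intro q₁ hq₁
        simp [haS q₁ hq₁]
    rw [this, Complex.norm_real, Real.norm_of_nonneg]
    exact Finset.sum_nonneg fun q₁ _ => by have := ha0 q₁; have := hb0 (q₁⁻¹ * q); positivity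
  have hfibN : ∀ q, N (fun h => cv (ι h * σ q)) ≤ ‖D q‖ := by
    intro q
    simp only [hcvu, hDn]
    exact (N_sum T _ (huF q)).trans (Finset.sum_le_sum fun q₁ _ => hcu q q₁)
  have hfibsq : ∀ q, ∑' h, ‖cv (ι h * σ q)‖ ^ 2 ≤ ‖D q‖ ^ 2 := by
    intro q
    rw [← N_sq]
    exact pow_le_pow_left₀ (N_nonneg _) (hfibN q) 2
  have hnsq : ∀ {X : Type _} (v : X → ℂ), (Function.support v).Finite →
      (Function.support fun x => ‖v x‖ ^ 2).Finite := by
    intro X v hv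
    exact hv.subset fun x hx hx' => hx (by simp [hx'])
  have hDsum : Summable fun q => ‖D q‖ ^ 2 :=
    summable_of_hasFiniteSupport (hDF.subset fun x hx hx' => hx (by simp [hx']))
  have hstep1 : ∑' x, ‖cv x‖ ^ 2 ≤ ∑' q, ‖D q‖ ^ 2 := by
    rw [sum_split ι π hι hexact σ hσ _ (hnsq cv hcvF)]
    refine Summable.tsum_le_tsum hfibsq ?_ hDsum
    exact Summable.of_nonneg_of_le (fun q => tsum_nonneg fun _ => by positivity) hfibsq hDsum
  have hstep2 := hQ (fun q => ((C * a q : ℝ) : ℂ)) (fun q => ((b q : ℝ) : ℂ)) haF hbF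
  -- the right-hand side
  have hbsum : ∑' q, ‖((b q : ℝ) : ℂ)‖ ^ 2 = ∑' x, ‖g x‖ ^ 2 := by
    rw [sum_split ι π hι hexact σ hσ _ (hnsq g hg)]
    refine tsum_congr fun q => ?_
    rw [Complex.norm_real, Real.norm_of_nonneg (hb0 q),
      ← hbeq 1 (σ q) q (by simp [hσ]), N_sq]
    simp
  have hasum : ∑' q, ‖((C * a q : ℝ) : ℂ)‖ ^ 2 * (1 + LQ q) ^ (2 * k') ≤
      (C * W ^ k) ^ 2 * ∑' x, ‖f x‖ ^ 2 * (1 + LG x) ^ (2 * (m * k + k')) := by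
    have hFF : (Function.support fun x => ‖f x‖ ^ 2 * (1 + LG x) ^ (2 * (m * k + k'))).Finite :=
      hf.subset fun x hx hx' => hx (by simp [hx'])
    rw [sum_split ι π hι hexact σ hσ _ hFF, ← tsum_mul_left]
    have hle : ∀ q, ‖((C * a q : ℝ) : ℂ)‖ ^ 2 * (1 + LQ q) ^ (2 * k') ≤
        (C * W ^ k) ^ 2 * ∑' h, ‖f (ι h * σ q)‖ ^ 2 * (1 + LG (ι h * σ q)) ^ (2 * (m * k + k')) := by
      intro q
      have hpos : 0 ≤ C * a q := mul_nonneg hC.le (ha0 q)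
      rw [Complex.norm_real, Real.norm_of_nonneg hpos, mul_pow, ha]
      simp only
      rw [Real.sq_sqrt (tsum_nonneg fun h => by have := hLH h; positivity), mul_assoc, mul_pow,
        mul_assoc]
      refine mul_le_mul_of_nonneg_left ?_ (by positivity)
      rw [← tsum_mul_right, ← tsum_mul_left]
      refine Summable.tsum_le_tsum (fun h => ?_) ?_ ?_
      · have h1 := hb1 h q
        have h2 := hb2 h q
        have h3 := hLH h
        have h4 := hLQ q
        have h5 := hLG (ι h * σ q)
        set y := 1 + LG (ι h * σ q) with hy
        have hy0 : 0 ≤ y := by positivity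
        calc ‖f (ι h * σ q)‖ ^ 2 * (1 + LH h) ^ (2 * k) * (1 + LQ q) ^ (2 * k')
            ≤ ‖f (ι h * σ q)‖ ^ 2 * (W * y ^ m) ^ (2 * k) * y ^ (2 * k') := by
              gcongr
              linarith
          _ = (W ^ k) ^ 2 * (‖f (ι h * σ q)‖ ^ 2 * y ^ (2 * (m * k + k'))) := by ring
      · exact summable_of_hasFiniteSupport ((hffib q).subset fun x hx hx' => hx (by
          simp only at hx'; simp [hx']))
      · exact summable_of_hasFiniteSupport ((hffib q).subset fun x hx hx' => hx (by
          simp only at hx'; simp [hx']))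
    refine Summable.tsum_le_tsum hle ?_ ?_
    · exact summable_of_hasFiniteSupport (haF.subset fun x hx hx' => hx (by
          simp only at hx'; simp only [hx']; simp))
    · exact summable_of_hasFiniteSupport (T.finite_toSet.subset fun q hq => by
          by_contra hn
          exact hq (by simp [hfT q hn]))
  calc Real.sqrt (∑' x, ‖cv x‖ ^ 2) ≤ Real.sqrt (∑' q, ‖D q‖ ^ 2) := Real.sqrt_le_sqrt hstep1
    _ ≤ C' * Real.sqrt (∑' q, ‖((C * a q : ℝ) : ℂ)‖ ^ 2 * (1 + LQ q) ^ (2 * k')) *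
        Real.sqrt (∑' q, ‖((b q : ℝ) : ℂ)‖ ^ 2) := hstep2
    _ ≤ C' * (C * W ^ k * Real.sqrt (∑' x, ‖f x‖ ^ 2 * (1 + LG x) ^ (2 * (m * k + k')))) *
        Real.sqrt (∑' x, ‖g x‖ ^ 2) := by
        rw [hbsum]
        gcongr
        refine (Real.sqrt_le_sqrt hasum).trans ?_
        rw [Real.sqrt_mul (by positivity), Real.sqrt_sq (by positivity)]
    _ = _ := by ring

theorem aux1 {D x x' y y' : ℝ} (k : ℕ) (hD : 0 < D) (hx : 0 ≤ x) (hy : 0 ≤ y) (hxx : x ≤ x')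
    (hyy : y ≤ y') : D * x * y ^ k ≤ D * x' * y' ^ k := by
  have : 0 ≤ x' := hx.trans hxx
  gcongr

section Len
variable {H G Q : Type*} [Group H] [Group G] [Group Q]

theorem conj_len (ι : H →* G) (σ : Q → G) (LH : H → ℝ) (LQ : Q → ℝ)
    (hLH : ∀ h, 0 ≤ LH h) (hLQ : ∀ q, 0 ≤ LQ q)
    (hmul : ∀ a b, LH (a * b) ≤ LH a + LH b) (hinv : ∀ a, LH a⁻¹ ≤ LH a)
    (hinvQ : ∀ a, LQ a⁻¹ ≤ LQ a)
    (fs : Q → Q → H) (hfs : ∀ q₁ q₂, σ q₁ * σ q₂ = σ (q₁ * q₂) * ι (fs q₁ q₂))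
    (conj : H → Q → H) (hconj : ∀ (h : H) (q : Q), ι (conj h q) = (σ q)⁻¹ * ι h * σ q)
    (C : ℝ) (hC : 0 < C) (R : ℕ)
    (hf : ∀ p q, LH (fs p q) ≤ C * ((1 + LQ p) * (1 + LQ q)) ^ R)
    (hc : ∀ h q, LH (conj h q) ≤ C * LH h * (1 + LQ q) ^ R) :
    ∃ D : ℝ, 0 < D ∧ ∀ a q, ∃ a', ι a' = σ q * ι a * (σ q)⁻¹ ∧
      LH a' ≤ D * (1 + LH a) * (1 + LQ q) ^ (2 * R) := by
  have hσ1 : σ 1 = ι (fs 1 1) := by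
    have := hfs 1 1
    rw [mul_one] at this
    exact mul_left_cancel this
  refine ⟨2 * (LH (fs 1 1) + C) + C, by have := hLH (fs 1 1); positivity, fun a q => ?_⟩
  set d := fs 1 1 * fs q q⁻¹ with hd
  have hσq : σ q = ι d * (σ q⁻¹)⁻¹ := by
    rw [eq_mul_inv_iff_mul_eq, hfs, mul_inv_cancel, hσ1, hd, map_mul]
  refine ⟨d * conj a q⁻¹ * d⁻¹, ?_, ?_⟩
  · rw [map_mul, map_mul, hconj, hσq, map_inv]; group
  · have h1 := hmul (d * conj a q⁻¹) d⁻¹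
    have h2 := hmul d (conj a q⁻¹)
    have h3 := hinv d
    have h4 : LH d ≤ _ := hmul (fs 1 1) (fs q q⁻¹)
    have h5 := hf q q⁻¹
    have h6 := hc a q⁻¹
    have h7 := hinvQ q
    have h8 := hLH a
    have h9 := hLQ q
    have h10 := hLQ q⁻¹
    set x := 1 + LQ q with hx
    have hx1 : 1 ≤ x := by linarith
    have h5' : LH (fs q q⁻¹) ≤ C * x ^ (2 * R) := by
      calc _ ≤ C * (x * (1 + LQ q⁻¹)) ^ R := h5
        _ ≤ C * (x * x) ^ R := by gcongr; linarith
        _ = _ := by rw [← sq, ← pow_mul]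
    have h6' : LH (conj a q⁻¹) ≤ C * LH a * x ^ (2 * R) := by
      calc _ ≤ C * LH a * (1 + LQ q⁻¹) ^ R := h6
        _ ≤ C * LH a * x ^ R := by gcongr; linarith
        _ ≤ _ := by gcongr <;> first | exact hx1 | omega
    have hxp : 1 ≤ x ^ (2 * R) := one_le_pow₀ hx1
    have h11 := hLH (fs 1 1)
    have e1 : LH (fs 1 1) ≤ LH (fs 1 1) * x ^ (2 * R) := le_mul_of_one_le_right h11 hxp
    have e2 : 0 ≤ 2 * (LH (fs 1 1) + C) * LH a * x ^ (2 * R) := by positivity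
    have e3 : 0 ≤ C * x ^ (2 * R) := by positivity
    nlinarith

theorem word_len (ι : H →* G) (π : G →* Q) (hπι : ∀ h, π (ι h) = 1)
    (σ : Q → G) (hσ : ∀ q, π (σ q) = q) (A : Set H) (B : Set Q) (LH : H → ℝ) (LQ : Q → ℝ)
    (hLH : ∀ h, 0 ≤ LH h) (hLQ : ∀ q, 0 ≤ LQ q)
    (hmul : ∀ a b, LH (a * b) ≤ LH a + LH b) (hinv : ∀ a, LH a⁻¹ ≤ LH a)
    (hmulQ : ∀ a b, LQ (a * b) ≤ LQ a + LQ b) (hinvQ : ∀ a, LQ a⁻¹ ≤ LQ a) (hQ1 : LQ 1 ≤ 0)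
    (hA : ∀ a ∈ A, LH a ≤ 1) (hB : ∀ a ∈ B, LQ a ≤ 1)
    (fs : Q → Q → H) (hfs : ∀ q₁ q₂, σ q₁ * σ q₂ = σ (q₁ * q₂) * ι (fs q₁ q₂))
    (C : ℝ) (hC : 0 < C) (R : ℕ)
    (hf : ∀ p q, LH (fs p q) ≤ C * ((1 + LQ p) * (1 + LQ q)) ^ R)
    (D : ℝ) (hD : 0 < D) (hcj : ∀ a q, ∃ a', ι a' = σ q * ι a * (σ q)⁻¹ ∧
      LH a' ≤ D * (1 + LH a) * (1 + LQ q) ^ (2 * R)) (w : List G)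
    (hw : ∀ x ∈ w, x ∈ ι '' A ∪ σ '' B ∨ x⁻¹ ∈ ι '' A ∪ σ '' B) :
    LQ (π w.prod) ≤ w.length ∧ ∃ h, ι h * σ (π w.prod) = w.prod ∧
      LH h ≤ LH (fs 1 1) + w.length *
        (D * (2 + C * (4 * (1 + w.length)) ^ R) * (2 * (1 + w.length)) ^ (2 * R)) := by
  have hσ1 : σ 1 = ι (fs 1 1) := by
    have := hfs 1 1
    rw [mul_one] at this
    exact mul_left_cancel this
  induction w using List.reverseRecOn with
  | nil =>
    refine ⟨by simpa using hQ1, (fs 1 1)⁻¹, ?_, ?_⟩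
    · simp [hσ1]
    · simpa using hinv (fs 1 1)
  | append_singleton w s ih =>
    obtain ⟨ih1, h, ih2, ih3⟩ := ih fun x hx => hw x (by simp [hx])
    have hs := hw s (by simp)
    simp only [List.prod_append, List.prod_singleton, List.length_append, List.length_singleton,
      Nat.cast_add, Nat.cast_one, map_mul]
    set g := w.prod with hg
    set q := π g with hq
    set n : ℝ := (w.length : ℝ) with hn
    have hn0 : 0 ≤ n := by positivity
    -- the step
    have key : LQ (q * π s) ≤ n + 1 ∧ ∃ a, ι a * σ (q * π s) = σ q * s ∧
        LH a ≤ D * (2 + C * (4 * (1 + n)) ^ R) * (2 * (1 + n)) ^ (2 * R) := by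
      have hpow : 0 ≤ C * (4 * (1 + n)) ^ R := by positivity
      have hq0 := hLQ q
      -- case of an element of iota
      have caseι : ∀ a, LH a ≤ 1 → s = ι a → LQ (q * π s) ≤ n + 1 ∧ ∃ a, ι a * σ (q * π s) = σ q * s ∧
          LH a ≤ D * (2 + C * (4 * (1 + n)) ^ R) * (2 * (1 + n)) ^ (2 * R) := by
        rintro a ha rfl
        rw [hπι, mul_one]
        refine ⟨by linarith, ?_⟩
        obtain ⟨a', h1, h2⟩ := hcj a q
        refine ⟨a', by rw [h1]; group, h2.trans ?_⟩
        have := hLH a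
        exact aux1 _ hD (by linarith) (by linarith) (by linarith) (by linarith)
      have caseσ : ∀ t c q', LQ t ≤ 1 → LQ q' ≤ 1 + n → ι c = (σ q')⁻¹ * (σ q * s) * (σ (q * π s))⁻¹ * (σ q') →
          LQ (q * π s) ≤ n + 1 → LH c ≤ 1 + C * (4 * (1 + n)) ^ R → LQ (q * π s) ≤ n + 1 ∧ ∃ a, ι a * σ (q * π s) = σ q * s ∧
          LH a ≤ D * (2 + C * (4 * (1 + n)) ^ R) * (2 * (1 + n)) ^ (2 * R) := by
        intro t c q' ht hq' hc hl hcl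
        refine ⟨hl, ?_⟩
        obtain ⟨a', h1, h2⟩ := hcj c q'
        refine ⟨a', by rw [h1, hc]; group, h2.trans ?_⟩
        have := hLH c
        have := hLQ q'
        exact aux1 _ hD (by linarith) (by linarith) (by linarith) (by linarith)
      rcases hs with (⟨a, ha, hs⟩ | ⟨t, ht, hs⟩) | (⟨a, ha, hs⟩ | ⟨t, ht, hs⟩)
      · exact caseι a (hA a ha) hs.symm
      · have hπs : π s = t := by rw [← hs, hσ]
        have ht1 := hB t ht
        have hqt : LQ (q * t) ≤ n + 1 := (hmulQ q t).trans (by linarith)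
        refine caseσ t (fs q t) (q * t) ht1 (by linarith) ?_ (by rw [hπs]; exact hqt) ?_
        · rw [hπs, ← hs, hfs]; group
        · refine (hf q t).trans ?_
          have := hLQ t
          have : C * ((1 + LQ q) * (1 + LQ t)) ^ R ≤ C * (4 * (1 + n)) ^ R := by
            refine mul_le_mul_of_nonneg_left (pow_le_pow_left₀ (by positivity) ?_ _) hC.le
            have h1 : 1 + LQ q ≤ 2 * (1 + n) := by linarith
            have h2 : 1 + LQ t ≤ 2 := by linarith
            have := mul_le_mul h1 h2 (by positivity) (by positivity)
            linarith
          linarith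
      · refine caseι a⁻¹ ((hinv a).trans (hA a ha)) ?_
        rw [map_inv, hs, inv_inv]
      · have hs' : s = (σ t)⁻¹ := by rw [hs, inv_inv]
        have hπs : π s = t⁻¹ := by rw [hs', map_inv, hσ]
        have ht1 := hB t ht
        have hqt : LQ (q * t⁻¹) ≤ n + 1 := (hmulQ q t⁻¹).trans (by linarith [hinvQ t])
        refine caseσ t (fs (q * t⁻¹) t)⁻¹ q ht1 (by linarith) ?_ (by rw [hπs]; exact hqt) ?_
        · have := hfs (q * t⁻¹) t
          rw [inv_mul_cancel_right] at this
          rw [hπs, hs', map_inv, eq_inv_mul_iff_mul_eq.2 this.symm]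
          group
        · refine (hinv _).trans ((hf _ t).trans ?_)
          have := hLQ t
          have := hLQ (q * t⁻¹)
          have : C * ((1 + LQ (q * t⁻¹)) * (1 + LQ t)) ^ R ≤ C * (4 * (1 + n)) ^ R := by
            refine mul_le_mul_of_nonneg_left (pow_le_pow_left₀ (by positivity) ?_ _) hC.le
            have h1 : 1 + LQ (q * t⁻¹) ≤ 2 * (1 + n) := by linarith
            have h2 : 1 + LQ t ≤ 2 := by linarith
            have := mul_le_mul h1 h2 (by positivity) (by positivity)
            linarith
          linarith
    obtain ⟨k1, a, k2, k3⟩ := key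
    refine ⟨k1, h * a, ?_, ?_⟩
    · rw [map_mul, mul_assoc, k2, ← mul_assoc, ih2]
    · have e1 := hmul h a
      have e2 : D * (2 + C * (4 * (1 + n)) ^ R) * (2 * (1 + n)) ^ (2 * R) ≤
        D * (2 + C * (4 * (1 + (n + 1))) ^ R) * (2 * (1 + (n + 1))) ^ (2 * R) := by
        gcongr <;> linarith
      have e3 := mul_le_mul_of_nonneg_left e2 hn0
      linarith

end Len

theorem gen_top {H G Q : Type*} [Group H] [Group G] [Group Q]
    (ι : H →* G) (π : G →* Q) (hexact : ι.range = π.ker)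
    (σ : Q → G) (hσ : ∀ q, π (σ q) = q) (A : Set H) (hA : Subgroup.closure A = ⊤)
    (B : Set Q) (hB : Subgroup.closure B = ⊤) :
    Subgroup.closure (ι '' A ∪ σ '' B) = ⊤ := by
  set K := Subgroup.closure (ι '' A ∪ σ '' B) with hK
  have h1 : ι.range ≤ K := by
    rw [MonoidHom.range_eq_map, ← hA, MonoidHom.map_closure]
    exact Subgroup.closure_mono Set.subset_union_left
  have h2 : K.map π = ⊤ := by
    rw [eq_top_iff, ← hB, Subgroup.closure_le]
    intro t ht
    exact ⟨σ t, Subgroup.subset_closure (Or.inr ⟨t, ht, rfl⟩), hσ t⟩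
  rw [eq_top_iff]
  intro g _
  have : π g ∈ K.map π := by rw [h2]; trivial
  obtain ⟨k, hk, hkg⟩ := this
  have hmem : g * k⁻¹ ∈ K := h1 (by rw [hexact, MonoidHom.mem_ker]; simp [hkg])
  simpa using K.mul_mem hmem hk

end PolyExt

/-- (Noskov) A polynomial extension of a group with the Rapid Decay property by a group
with the Rapid Decay property again has the Rapid Decay property, with respect to the
word-length associated to the generating set `ι(A) ∪ σ(𝒬)`. -/
theorem rapidDecay_of_polynomial_extension
    {H G Q : Type*} [Group H] [Group G] [Group Q]
    (ι : H →* G) (π : G →* Q)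
    (hι : Function.Injective ι) (hπ : Function.Surjective π)
    (hexact : ι.range = π.ker)
    (σ : Q → G) (hσ : ∀ q, π (σ q) = q)
    (A : Finset H) (hA : Subgroup.closure (A : Set H) = ⊤)
    (𝒬 : Finset Q) (h𝒬 : Subgroup.closure (𝒬 : Set Q) = ⊤)
    (fs : Q → Q → H)
    (hfs : ∀ q₁ q₂, σ q₁ * σ q₂ = σ (q₁ * q₂) * ι (fs q₁ q₂))
    (conj : H → Q → H)
    (hconj : ∀ (h : H) (q : Q), ι (conj h q) = (σ q)⁻¹ * ι h * σ q)
    (C₀ r₀ : ℝ) (hC₀ : 0 < C₀) (hr₀ : 0 < r₀)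
    (hfs_poly : ∀ q₁ q₂ : Q,
      (wordLength (A : Set H) (fs q₁ q₂) : ℝ) ≤
        C₀ * ((1 + (wordLength (𝒬 : Set Q) q₁ : ℝ)) *
              (1 + (wordLength (𝒬 : Set Q) q₂ : ℝ))) ^ r₀)
    (hconj_poly : ∀ (h : H) (q : Q),
      (wordLength (A : Set H) (conj h q) : ℝ) ≤
        C₀ * (wordLength (A : Set H) h : ℝ) *
          (1 + (wordLength (𝒬 : Set Q) q : ℝ)) ^ r₀)
    (hH : RapidDecay H (fun h => (wordLength (A : Set H) h : ℝ)))
    (hQ : RapidDecay Q (fun q => (wordLength (𝒬 : Set Q) q : ℝ))) :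
    RapidDecay G
      (fun g => (wordLength (ι '' (A : Set H) ∪ σ '' (𝒬 : Set Q)) g : ℝ)) := by
  obtain ⟨R, hR⟩ := exists_nat_ge r₀
  set LH : H → ℝ := fun h => (wordLength (A : Set H) h : ℝ) with hLHd
  set LQ : Q → ℝ := fun q => (wordLength (𝒬 : Set Q) q : ℝ) with hLQd
  have hLH : ∀ h, 0 ≤ LH h := fun h => Nat.cast_nonneg _
  have hLQ : ∀ h, 0 ≤ LQ h := fun h => Nat.cast_nonneg _
  have hmul : ∀ a b, LH (a * b) ≤ LH a + LH b := fun a b => by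
    simp only [hLHd, hLQd]; exact_mod_cast PolyExt.wl_mul hA a b
  have hmulQ : ∀ a b, LQ (a * b) ≤ LQ a + LQ b := fun a b => by
    simp only [hLHd, hLQd]; exact_mod_cast PolyExt.wl_mul h𝒬 a b
  have hinv : ∀ a, LH a⁻¹ ≤ LH a := fun a => by simp only [hLHd, hLQd]; exact_mod_cast PolyExt.wl_inv_le hA a
  have hinvQ : ∀ a, LQ a⁻¹ ≤ LQ a := fun a => by simp only [hLHd, hLQd]; exact_mod_cast PolyExt.wl_inv_le h𝒬 a
  have hQ1 : LQ 1 ≤ 0 := by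
    have := PolyExt.wl_le (S := (𝒬 : Set Q)) [] (by simp)
    simp only [List.prod_nil, List.length_nil] at this
    simp only [hLQd]; exact_mod_cast this
  have hA1 : ∀ a ∈ (A : Set H), LH a ≤ 1 := fun a ha => by
    simp only [hLHd, hLQd]; exact_mod_cast PolyExt.wl_gen (Or.inl ha)
  have hB1 : ∀ a ∈ (𝒬 : Set Q), LQ a ≤ 1 := fun a ha => by
    simp only [hLHd, hLQd]; exact_mod_cast PolyExt.wl_gen (Or.inl ha)
  have hrp : ∀ x : ℝ, 1 ≤ x → x ^ r₀ ≤ x ^ R := fun x hx => by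
    rw [← Real.rpow_natCast]
    exact Real.rpow_le_rpow_of_exponent_le hx hR
  have hf : ∀ p q, LH (fs p q) ≤ C₀ * ((1 + LQ p) * (1 + LQ q)) ^ R := fun p q => by
    refine (hfs_poly p q).trans (mul_le_mul_of_nonneg_left (hrp _ ?_) hC₀.le)
    have := hLQ p
    have := hLQ q
    exact one_le_mul_of_one_le_of_one_le (by linarith) (by linarith)
  have hc : ∀ h q, LH (conj h q) ≤ C₀ * LH h * (1 + LQ q) ^ R := fun h q => by
    refine (hconj_poly h q).trans (mul_le_mul_of_nonneg_left (hrp _ ?_) (mul_nonneg hC₀.le (hLH h)))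
    have := hLQ q
    linarith
  obtain ⟨D, hD, hcj⟩ := PolyExt.conj_len ι σ LH LQ hLH hLQ hmul hinv hinvQ fs hfs conj hconj
    C₀ hC₀ R hf hc
  have hπι := PolyExt.pi_iota ι π hι hexact
  have hgen := PolyExt.gen_top ι π hexact σ hσ (A : Set H) hA (𝒬 : Set Q) h𝒬
  have hword : ∀ h q, LQ q ≤ wordLength (ι '' (A : Set H) ∪ σ '' (𝒬 : Set Q)) (ι h * σ q) ∧
      LH h ≤ LH (fs 1 1) + (wordLength (ι '' (A : Set H) ∪ σ '' (𝒬 : Set Q)) (ι h * σ q) : ℝ) *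
        (D * (2 + C₀ * (4 * (1 + (wordLength (ι '' (A : Set H) ∪ σ '' (𝒬 : Set Q)) (ι h * σ q) : ℝ))) ^ R) *
        (2 * (1 + (wordLength (ι '' (A : Set H) ∪ σ '' (𝒬 : Set Q)) (ι h * σ q) : ℝ))) ^ (2 * R)) := by
    intro h q
    obtain ⟨w, hw1, hw2, hw3⟩ := PolyExt.wl_exists hgen (ι h * σ q)
    obtain ⟨k1, h', k2, k3⟩ := PolyExt.word_len ι π hπι σ hσ A 𝒬 LH LQ hLH hLQ hmul hinv hmulQ hinvQ hQ1 hA1 hB1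
      fs hfs C₀ hC₀ R hf D hD hcj w hw2
    rw [hw3] at k1 k2
    have hπ' : π (ι h * σ q) = q := by rw [map_mul, hπι, hσ, one_mul]
    rw [hπ'] at k1 k2
    have : h' = h := hι (mul_right_cancel k2)
    subst this
    rw [hw1] at k1 k3
    exact ⟨k1, k3⟩
  refine PolyExt.analytic ι π hι hexact σ hσ LH LQ _ hLH hLQ (fun g => Nat.cast_nonneg _)
    (1 + LH (fs 1 1) + D * (2 + C₀ * 4 ^ R) * 2 ^ (2 * R))
    (by have := hLH (fs 1 1); positivity) (3 * R + 1) ?_ (fun h q => (hword h q).1) hH hQ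
  intro h q
  have h2 := (hword h q).2
  set n : ℝ := (wordLength (ι '' (A : Set H) ∪ σ '' (𝒬 : Set Q)) (ι h * σ q) : ℝ) with hn
  have hn0 : 0 ≤ n := Nat.cast_nonneg _
  set x : ℝ := 1 + n with hx
  have hx1 : 1 ≤ x := by linarith
  have hc0 := hLH (fs 1 1)
  have e1 : (1 + LH (fs 1 1)) ≤ (1 + LH (fs 1 1)) * x ^ (3 * R + 1) :=
    le_mul_of_one_le_right (by linarith) (one_le_pow₀ hx1)
  have hxR : 1 ≤ x ^ R := one_le_pow₀ hx1
  have e2 : n * (D * (2 + C₀ * (4 * x) ^ R) * (2 * x) ^ (2 * R)) ≤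
      D * (2 + C₀ * 4 ^ R) * 2 ^ (2 * R) * x ^ (3 * R + 1) := by
    calc n * (D * (2 + C₀ * (4 * x) ^ R) * (2 * x) ^ (2 * R))
        ≤ x * (D * (2 * x ^ R + C₀ * (4 * x) ^ R) * (2 * x) ^ (2 * R)) := by
          gcongr <;> linarith
      _ = _ := by
          rw [mul_pow, mul_pow]; ring
  show 1 + LH h ≤ (1 + LH (fs 1 1) + D * (2 + C₀ * 4 ^ R) * 2 ^ (2 * R)) * x ^ (3 * R + 1)
  linarith
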